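/- arXiv:1001.4470 — 2 statements merged into one kernel-verified Lean document; each statement's English description precedes it below -/
import Mathlib

section
/- If D ∈ A, then (J·B) ∩ A = D·A as ideals of A; that is, the contraction to A of the principal ideal of B generated by the Jacobian J is the principal ideal of A generated by the discriminant D. -/
noncomputable section

open MvPolynomial

/-- The multiplicity of `Q` in the factorization of `P` equals `e`. -/
def MultIs {σ : Type} (Q P : MvPolynomial σ ℂ) (e : ℕ) : Prop :=
  Q ^ e ∣ P ∧ ¬ Q ^ (e + 1) ∣ P

/-- The Jacobian `det (∂ f i / ∂ X j)` of an `n`-tuple of polynomials. -/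
def Jac {n : ℕ} (f : Fin n → MvPolynomial (Fin n) ℂ) : MvPolynomial (Fin n) ℂ :=
  (Matrix.of fun i j : Fin n => pderiv j (f i)).det

/-- `RamIdx A Q e` : the contraction `QB ∩ A` is generated by an irreducible `P ∈ A`,
and `e` is the multiplicity of `Q` in the factorization of `P` in `B`. -/
def RamIdx {σ : Type} (A : Subalgebra ℂ (MvPolynomial σ ℂ))
    (Q : MvPolynomial σ ℂ) (e : ℕ) : Prop :=
  ∃ P : A, Irreducible P ∧
    (Ideal.span {Q}).comap (algebraMap A (MvPolynomial σ ℂ)) = Ideal.span {P} ∧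
    MultIs Q (P : MvPolynomial σ ℂ) e

/-- `Q` is a ramified irreducible of `B` over `A`. -/
def IsRamified {σ : Type} (A : Subalgebra ℂ (MvPolynomial σ ℂ))
    (Q : MvPolynomial σ ℂ) : Prop :=
  Irreducible Q ∧ ∃ e, RamIdx A Q e ∧ 1 < e

/-- `RamReps A S e` : `S` is a finite set of pairwise non-associated irreducible elements of `B`,
each ramified with ramification index `e Q`, and every ramified irreducible of `B` is associated
to exactly one element of `S`. -/
def RamReps {σ : Type} (A : Subalgebra ℂ (MvPolynomial σ ℂ))
    (S : Finset (MvPolynomial σ ℂ)) (e : MvPolynomial σ ℂ → ℕ) : Prop :=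
  (∀ Q ∈ S, Irreducible Q ∧ RamIdx A Q (e Q) ∧ 1 < e Q) ∧
  (∀ Q ∈ S, ∀ Q' ∈ S, Q ≠ Q' → ¬ Associated Q Q') ∧
  (∀ Q : MvPolynomial σ ℂ, IsRamified A Q → ∃! Q', Q' ∈ S ∧ Associated Q Q')

/-- The polynomial map `ℂⁿ → ℂⁿ` associated to an `n`-tuple of polynomials. -/
def polyMap {n : ℕ} (f : Fin n → MvPolynomial (Fin n) ℂ) : (Fin n → ℂ) → (Fin n → ℂ) :=
  fun x i => eval x (f i)

/-- The branch locus: points whose fiber has fewer than `r` elements. -/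
def branchLocus {n : ℕ} (f : Fin n → MvPolynomial (Fin n) ℂ) (r : ℕ) : Set (Fin n → ℂ) :=
  {u | (polyMap f ⁻¹' {u}).Finite ∧ (polyMap f ⁻¹' {u}).ncard < r}

end

section

open MvPolynomial

open scoped Matrix in
/-- The matrix determinant lemma over a domain, without an invertibility hypothesis. -/
theorem det_add_vecMulVec_of_isDomain {m R : Type*} [Fintype m] [DecidableEq m] [CommRing R]
    [IsDomain R] (N : Matrix m m R) (u v : m → R) :
    (N + Matrix.vecMulVec u v).det = N.det + v ⬝ᵥ (N.adjugate *ᵥ u) := by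
  have of_field : ∀ {K : Type _} [Field K] (N : Matrix m m K) (u v : m → K), N.det ≠ 0 →
      (N + Matrix.vecMulVec u v).det = N.det + v ⬝ᵥ (N.adjugate *ᵥ u) := by
    intro K _ N u v hN
    have h := Matrix.det_add_replicateCol_mul_replicateRow (ι := Unit) (IsUnit.mk0 _ hN) u v
    rw [← Matrix.vecMulVec_eq] at h
    rw [h, Matrix.det_unique (n := Unit), Matrix.add_apply, Matrix.one_apply_eq, mul_add, mul_one,
      Matrix.mul_assoc, Matrix.inv_def, Ring.inverse_eq_inv']
    congr 1
    rw [Matrix.smul_mul, Matrix.mul_smul, Matrix.smul_apply, smul_eq_mul, mul_inv_cancel_left₀ hN]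
    rfl
  have map_lhs : ∀ {S T : Type _} [CommRing S] [CommRing T] (φ : S →+* T) (N : Matrix m m S)
      (u v : m → S), φ (N + Matrix.vecMulVec u v).det =
        (φ.mapMatrix N + Matrix.vecMulVec (φ ∘ u) (φ ∘ v)).det := by
    intro S T _ _ φ N u v
    rw [RingHom.map_det, map_add]
    congr 2
    ext i j
    simp [Matrix.vecMulVec_apply]
  have map_rhs : ∀ {S T : Type _} [CommRing S] [CommRing T] (φ : S →+* T) (N : Matrix m m S)
      (u v : m → S), φ (N.det + v ⬝ᵥ (N.adjugate *ᵥ u)) = (φ.mapMatrix N).det +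
        (φ ∘ v) ⬝ᵥ ((φ.mapMatrix N).adjugate *ᵥ (φ ∘ u)) := by
    intro S T _ _ φ N u v
    rw [map_add, RingHom.map_det, RingHom.map_dotProduct, ← RingHom.map_adjugate]
    congr 2
    ext i
    simp [RingHom.map_mulVec]
  have of_ne_zero : ∀ {S : Type _} [CommRing S] [IsDomain S] (N : Matrix m m S) (u v : m → S),
      N.det ≠ 0 → (N + Matrix.vecMulVec u v).det = N.det + v ⬝ᵥ (N.adjugate *ᵥ u) := by
    intro S _ _ N u v hN
    have hφ := IsFractionRing.injective S (FractionRing S)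
    apply hφ
    rw [map_lhs, map_rhs]
    refine of_field _ _ _ ?_
    rw [← RingHom.map_det]
    exact (map_ne_zero_iff _ hφ).2 hN
  have h := congrArg (Polynomial.evalRingHom (0 : R)) (of_ne_zero (Matrix.charmatrix (-N))
    (Polynomial.C ∘ u) (Polynomial.C ∘ v) (Matrix.charpoly_monic (-N)).ne_zero)
  have hN : (Polynomial.evalRingHom (0 : R)).mapMatrix (Matrix.charmatrix (-N)) = N := by
    ext i j
    by_cases hij : i = j
    · subst hij; simp [Matrix.charmatrix_apply_eq]
    · simp [Matrix.charmatrix_apply_ne _ _ _ hij]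
  have hC : ∀ w : m → R, Polynomial.evalRingHom (0 : R) ∘ Polynomial.C ∘ w = w := by
    intro w; ext i; simp
  rwa [map_lhs, map_rhs, hN, hC, hC] at h

open scoped Matrix in
theorem det_mul_add_vecMulVec_eq_zero {m R : Type*} [Fintype m] [DecidableEq m] [CommRing R]
    [IsDomain R] {M : Matrix m m R} (C : Matrix m m R) (u : m → R) {v : m → R} (hM : M.det = 0)
    (hv : v ᵥ* M.adjugate = 0) : (C * M + Matrix.vecMulVec u v).det = 0 := by
  rw [det_add_vecMulVec_of_isDomain, Matrix.det_mul, hM, mul_zero, zero_add,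
    Matrix.adjugate_mul_distrib, Matrix.dotProduct_mulVec, ← Matrix.vecMul_vecMul, hv]
  simp

/-- The gradient of a polynomial in finitely many variables. -/
noncomputable def grad {n : ℕ} (x : MvPolynomial (Fin n) ℂ) : Fin n → MvPolynomial (Fin n) ℂ :=
  fun l => pderiv l x

open scoped Matrix in
theorem grad_aeval {n : ℕ} (f : Fin n → MvPolynomial (Fin n) ℂ) (F : MvPolynomial (Fin n) ℂ) :
    grad (aeval f F) = (fun i => aeval f (pderiv i F)) ᵥ*
      Matrix.of fun i j : Fin n => pderiv j (f i) := by
  funext l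
  simp only [grad, Matrix.vecMul, dotProduct, Matrix.of_apply]
  induction F using MvPolynomial.induction_on with
  | C a => simp
  | add p q hp hq => simp only [map_add, hp, hq, add_mul, Finset.sum_add_distrib]
  | mul_X p i hp =>
    simp only [map_mul, aeval_X, Derivation.leibniz, smul_eq_mul, hp, map_add, add_mul,
      Finset.sum_add_distrib, pderiv_X, Pi.single_apply, Finset.mul_sum]
    simp [mul_assoc]

open scoped Matrix in
theorem exists_grad_aeval {n : ℕ} {f : Fin n → MvPolynomial (Fin n) ℂ}
    {A : Subalgebra ℂ (MvPolynomial (Fin n) ℂ)} (hA : A = Algebra.adjoin ℂ (Set.range f))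
    (x : MvPolynomial (Fin n) ℂ) (g : Polynomial A) :
    ∃ c : Fin n → MvPolynomial (Fin n) ℂ, grad (Polynomial.aeval x g) =
      c ᵥ* (Matrix.of fun i j : Fin n => pderiv j (f i)) +
        Polynomial.aeval x g.derivative • grad x := by
  induction g using Polynomial.induction_on' with
  | add p q hp hq =>
    obtain ⟨c, hc⟩ := hp
    obtain ⟨d, hd⟩ := hq
    refine ⟨c + d, ?_⟩
    have : grad (Polynomial.aeval x p + Polynomial.aeval x q) =
      grad (Polynomial.aeval x p) + grad (Polynomial.aeval x q) := by
      funext l; simp [grad]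
    simp only [map_add, this, hc, hd, Matrix.add_vecMul, add_smul]
    abel
  | monomial k a =>
    obtain ⟨a, ha⟩ := a
    have ha' := ha
    rw [hA, Algebra.adjoin_range_eq_range_aeval] at ha'
    obtain ⟨F, hF⟩ := ha'
    have h := grad_aeval f F
    have hF : aeval f F = a := hF
    rw [hF] at h
    refine ⟨x ^ k • (fun i => aeval f (pderiv i F)), ?_⟩
    rw [Matrix.smul_vecMul, ← h]
    funext l
    simp [grad, Polynomial.aeval_monomial, Polynomial.derivative_monomial,
      Derivation.leibniz_pow]
    ring

/-- In characteristic zero, any element integral over `A` is a simple root modulo a prime of some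
polynomial over `A`. -/
theorem exists_aeval_mem_derivative_notMem {n : ℕ} {A : Subalgebra ℂ (MvPolynomial (Fin n) ℂ)}
    {I : Ideal (MvPolynomial (Fin n) ℂ)} (hI : I.IsPrime) {x : MvPolynomial (Fin n) ℂ}
    (hx : IsIntegral A x) :
    ∃ g : Polynomial A, Polynomial.aeval x g ∈ I ∧ Polynomial.aeval x g.derivative ∉ I := by
  obtain ⟨g₀, hm, h₀⟩ := hx
  have hex : ∃ d, ∃ g : Polynomial A, g.natDegree = d ∧ Polynomial.aeval x g ∈ I ∧
      ∃ k, (g.coeff k : MvPolynomial (Fin n) ℂ) ∉ I := by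
    refine ⟨_, g₀, rfl, ?_, g₀.natDegree, ?_⟩
    · rw [Polynomial.aeval_def, h₀]; exact I.zero_mem
    · rw [Polynomial.coeff_natDegree, hm]
      simpa using (Ideal.ne_top_iff_one I).1 hI.ne_top
  classical
  obtain ⟨g, hd, hg, hk⟩ := Nat.find_spec hex
  refine ⟨g, hg, fun hg' => ?_⟩
  have h0 : g.natDegree ≠ 0 := by
    intro h0
    obtain ⟨k, hk⟩ := hk
    rw [Polynomial.eq_C_of_natDegree_eq_zero h0] at hg hk
    rcases k with _ | k
    · apply hk
      simpa [Subalgebra.algebraMap_def] using hg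
    · apply hk
      simp
  have hmin := Nat.find_min hex (m := g.derivative.natDegree)
    (hd ▸ Polynomial.natDegree_derivative_lt h0)
  have hcoef : ∀ k, (g.derivative.coeff k : MvPolynomial (Fin n) ℂ) ∈ I := by
    by_contra! h
    exact hmin ⟨_, rfl, hg', h⟩
  have hpos : ∀ k, (g.coeff (k + 1) : MvPolynomial (Fin n) ℂ) ∈ I := by
    intro k
    have h := hcoef k
    rw [Polynomial.coeff_derivative] at h
    have h2 : ((g.coeff (k + 1) : A) : MvPolynomial (Fin n) ℂ) =
        C (((k : ℂ) + 1)⁻¹) * ((g.coeff (k + 1) * ((k : A) + 1) : A) : MvPolynomial (Fin n) ℂ) := by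
      have h3 : (C (((k : ℂ) + 1)⁻¹) : MvPolynomial (Fin n) ℂ) * ((k : MvPolynomial (Fin n) ℂ) + 1)
          = 1 := by
        rw [show ((k : MvPolynomial (Fin n) ℂ) + 1) = C ((k : ℂ) + 1) by simp, ← C_mul,
          inv_mul_cancel₀ (by exact_mod_cast k.succ_ne_zero), C_1]
      push_cast
      linear_combination (-(g.coeff (k + 1) : MvPolynomial (Fin n) ℂ)) * h3
    rw [h2]
    exact I.mul_mem_left _ h
  obtain ⟨k, hk⟩ := hk
  rcases k with _ | k
  · apply hk
    rw [Polynomial.aeval_eq_sum_range, Finset.sum_range_succ'] at hg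
    rw [I.add_mem_iff_right (I.sum_mem fun i _ => ?_)] at hg
    · simpa [Algebra.smul_def, Subalgebra.algebraMap_def] using hg
    · rw [Algebra.smul_def]
      exact I.mul_mem_right _ (hpos i)
  · exact hk (hpos k)

theorem grad_mul {n : ℕ} (x y : MvPolynomial (Fin n) ℂ) :
    grad (x * y) = x • grad y + y • grad x := by
  funext l; simp [grad]

theorem grad_X {n : ℕ} (j : Fin n) :
    grad (X j : MvPolynomial (Fin n) ℂ) = Pi.single j 1 := by
  funext l
  simp [grad, pderiv_X, Pi.single_apply, eq_comm]

theorem grad_pow_succ_mul {n : ℕ} (Q R : MvPolynomial (Fin n) ℂ) (k : ℕ) :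
    grad (Q ^ (k + 1) * R) = Q ^ k • (((k + 1 : ℕ) * R) • grad Q + Q • grad R) := by
  funext l
  simp [grad, Derivation.leibniz_pow]
  ring

open scoped Matrix in
/-- Along an element of `A`, the gradient times the adjugate of the Jacobian matrix is a multiple
of the Jacobian. -/
theorem grad_aeval_vecMul_adjugate {n : ℕ} (f : Fin n → MvPolynomial (Fin n) ℂ)
    (F : MvPolynomial (Fin n) ℂ) :
    grad (aeval f F) ᵥ* (Matrix.of fun i j : Fin n => pderiv j (f i)).adjugate =
      Jac f • fun i => aeval f (pderiv i F) := by
  rw [grad_aeval, Matrix.vecMul_vecMul, Matrix.mul_adjugate, Matrix.vecMul_smul, Matrix.vecMul_one]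
  rfl

open scoped Matrix in
/-- The Jacobian is divisible by an irreducible `Q` at most to the order `e - 1`, where `e` is the
multiplicity of `Q` in some element of `A`. -/
theorem not_pow_dvd_Jac {n : ℕ} {f : Fin n → MvPolynomial (Fin n) ℂ}
    {A : Subalgebra ℂ (MvPolynomial (Fin n) ℂ)} (hA : A = Algebra.adjoin ℂ (Set.range f))
    (hint : Algebra.IsIntegral A (MvPolynomial (Fin n) ℂ)) {Q : MvPolynomial (Fin n) ℂ}
    (hQ : Irreducible Q) {P : MvPolynomial (Fin n) ℂ} (hP : P ∈ A) {e : ℕ} (he : e ≠ 0)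
    (hm : MultIs Q P e) : ¬ Q ^ e ∣ Jac f := by
  intro hJ
  have hQp := hQ.prime
  obtain ⟨k, rfl⟩ := Nat.exists_eq_succ_of_ne_zero he
  obtain ⟨⟨R, hR⟩, hm⟩ := hm
  rw [Nat.succ_eq_add_one] at *
  have hQR : ¬ Q ∣ R := by
    rintro ⟨T, rfl⟩
    exact hm ⟨T, by rw [hR]; ring⟩
  have hI : (Ideal.span {Q}).IsPrime := (Ideal.span_singleton_prime hQp.ne_zero).2 hQp
  have hP' := hP
  rw [hA, Algebra.adjoin_range_eq_range_aeval] at hP'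
  obtain ⟨F, hF⟩ := hP'
  have hF : aeval f F = P := hF
  set M : Matrix (Fin n) (Fin n) (MvPolynomial (Fin n) ℂ) :=
    Matrix.of fun i j : Fin n => pderiv j (f i) with hM
  have hadj : ∀ l, Q ∣ (grad Q ᵥ* M.adjugate) l := by
    intro l
    have h := congrFun (grad_aeval_vecMul_adjugate f F) l
    rw [hF, hR, grad_pow_succ_mul, Matrix.smul_vecMul, Matrix.add_vecMul, Matrix.smul_vecMul,
      Matrix.smul_vecMul] at h
    simp only [Pi.smul_apply, Pi.add_apply, smul_eq_mul, ← hM] at h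
    obtain ⟨T, hT⟩ := hJ
    rw [hT] at h
    have h : ((k + 1 : ℕ) : MvPolynomial (Fin n) ℂ) * R * (grad Q ᵥ* M.adjugate) l +
        Q * (grad R ᵥ* M.adjugate) l = Q * (T * aeval f (pderiv l F)) :=
      mul_left_cancel₀ (pow_ne_zero k hQp.ne_zero) (by linear_combination h)
    have h2 : Q ∣ ((k + 1 : ℕ) : MvPolynomial (Fin n) ℂ) * R * (grad Q ᵥ* M.adjugate) l :=
      ⟨T * aeval f (pderiv l F) - (grad R ᵥ* M.adjugate) l, by linear_combination h⟩
    refine (hQp.dvd_or_dvd h2).resolve_left fun h3 => ?_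
    rcases hQp.dvd_or_dvd h3 with h4 | h4
    · refine hQp.not_isUnit (isUnit_of_dvd_unit h4 ?_)
      rw [← map_natCast (C : ℂ →+* MvPolynomial (Fin n) ℂ)]
      exact (IsUnit.mk0 _ (by exact_mod_cast k.succ_ne_zero)).map _
    · exact hQR h4
  choose g hg hg' using fun j => exists_aeval_mem_derivative_notMem hI (hint.isIntegral (X j))
  choose h hh using fun j => Ideal.mem_span_singleton.1 (hg j)
  choose c hc using fun j => exists_grad_aeval hA (X j) (g j)
  let φ := Ideal.Quotient.mk (Ideal.span {Q})
  have hφ : ∀ x, φ x = 0 ↔ Q ∣ x := fun x => by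
    rw [Ideal.Quotient.eq_zero_iff_mem, Ideal.mem_span_singleton]
  have hdet := det_mul_add_vecMulVec_eq_zero (M := φ.mapMatrix M) (φ.mapMatrix (-Matrix.of c)) (φ ∘ h)
    (v := φ ∘ grad Q)
    (by rw [← RingHom.map_det, hφ]; exact (dvd_pow_self Q he).trans hJ)
    (by
      funext l
      rw [← RingHom.map_adjugate, RingHom.mapMatrix_apply, ← RingHom.map_vecMul, Pi.zero_apply, hφ]
      exact hadj l)
  have hdiag : φ.mapMatrix (-Matrix.of c) * φ.mapMatrix M + Matrix.vecMulVec (φ ∘ h) (φ ∘ grad Q) =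
      Matrix.diagonal fun j => φ (Polynomial.aeval (X j) (g j).derivative) := by
    ext j l
    have h1 := congrArg φ (congrFun (hc j) l)
    rw [hh j, grad_mul, grad_X] at h1
    rw [← map_mul, Matrix.neg_mul, map_neg]
    have h2 : φ Q = 0 := (hφ Q).2 dvd_rfl
    simp only [Pi.add_apply, Pi.smul_apply, smul_eq_mul, map_add, map_mul, h2, zero_mul,
      zero_add] at h1
    have h3 : (φ.mapMatrix (Matrix.of c * M)) j l = φ ((c j ᵥ* M) l) := rfl
    rw [Matrix.add_apply, Matrix.neg_apply, h3, Matrix.vecMulVec_apply, Function.comp_apply,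
      Function.comp_apply, h1, Matrix.diagonal_apply, Pi.single_apply]
    by_cases hjl : j = l
    · simp [hjl, hM]
    · simp [hjl, Ne.symm hjl, hM]
  rw [hdiag, Matrix.det_diagonal, Finset.prod_eq_zero_iff] at hdet
  obtain ⟨j, -, hj⟩ := hdet
  exact hg' j (Ideal.Quotient.eq_zero_iff_mem.1 hj)

theorem eq_zero_of_dvd_pderiv {σ : Type*} {F : MvPolynomial σ ℂ} {i : σ} (h : F ∣ pderiv i F) :
    pderiv i F = 0 := by
  by_contra h0
  obtain ⟨G, hG⟩ := h
  have hF : F ≠ 0 := by rintro rfl; simp at h0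
  have hG0 : G ≠ 0 := by rintro rfl; simp [hG] at h0
  obtain ⟨m, hm, hd⟩ := Finset.exists_mem_eq_sup _ (support_nonempty.2 h0)
    (fun m => m.sum fun _ e => e)
  have hd : (pderiv i F).totalDegree = m.sum fun _ e => e := hd
  rw [mem_support_iff, coeff_pderiv] at hm
  have h1 := le_totalDegree (mem_support_iff.2 (left_ne_zero_of_mul hm))
  rw [Finsupp.sum_add_index' (by simp) (by simp), ← hd, hG, totalDegree_mul_of_isDomain hF hG0] at h1
  simp at h1

theorem exists_eq_C_of_pderiv_eq_zero {σ : Type*} {F : MvPolynomial σ ℂ}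
    (h : ∀ i, pderiv i F = 0) : ∃ a, F = C a := by
  classical
  refine ⟨F.coeff 0, ?_⟩
  ext m
  rw [coeff_C]
  split_ifs with hm
  · rw [hm]
  · obtain ⟨i, hi⟩ := Finsupp.ne_iff.1 (Ne.symm hm)
    have h1 := congrArg (coeff (m - Finsupp.single i 1)) (h i)
    rw [coeff_pderiv, coeff_zero, tsub_add_cancel_of_le] at h1
    · refine (mul_eq_zero.1 h1).resolve_right ?_
      exact Nat.cast_add_one_ne_zero _
    · simpa [Finsupp.single_le_iff] using Nat.one_le_iff_ne_zero.2 hi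

open scoped Matrix in
theorem dvd_Jac_of_one_lt {n : ℕ} {f : Fin n → MvPolynomial (Fin n) ℂ}
    {A : Subalgebra ℂ (MvPolynomial (Fin n) ℂ)} (hA : A = Algebra.adjoin ℂ (Set.range f))
    (hind : AlgebraicIndependent ℂ f) {Q : MvPolynomial (Fin n) ℂ}
    (hQ : Irreducible Q) {e : ℕ} (he : 1 < e) (hr : RamIdx A Q e) : Q ∣ Jac f := by
  obtain ⟨⟨P, hPA⟩, hP, hPQ, hm, -⟩ := hr
  have hmem : ∀ {x}, x ∈ A ↔ ∃ F, aeval f F = x := fun {x} => by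
    rw [hA, Algebra.adjoin_range_eq_range_aeval]; rfl
  obtain ⟨F, hF⟩ := hmem.1 hPA
  by_contra hJ
  have hdvd : ∀ i, Q ∣ aeval f (pderiv i F) := by
    intro i
    have h := congrFun (grad_aeval_vecMul_adjugate f F) i
    obtain ⟨k, rfl⟩ := Nat.exists_eq_add_of_le' he
    obtain ⟨R, hR⟩ := hm
    dsimp only at hR
    rw [hF, hR, grad_pow_succ_mul, Matrix.smul_vecMul] at h
    refine (hQ.prime.dvd_or_dvd (?_ : Q ∣ Jac f * _)).resolve_left hJ
    refine Dvd.dvd.trans (dvd_pow_self Q k.succ_ne_zero) ⟨_, h.symm⟩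
  have hF0 : ∀ i, pderiv i F = 0 := by
    intro i
    refine eq_zero_of_dvd_pderiv ?_
    have hiA : aeval f (pderiv i F) ∈ A := hmem.2 ⟨_, rfl⟩
    have h : (⟨_, hiA⟩ : A) ∈ Ideal.span {(⟨P, hPA⟩ : A)} := by
      rw [← hPQ, Ideal.mem_comap, Ideal.mem_span_singleton]
      exact hdvd i
    obtain ⟨⟨T, hT⟩, h⟩ := Ideal.mem_span_singleton.1 h
    obtain ⟨G, rfl⟩ := hmem.1 hT
    refine ⟨G, hind ?_⟩
    rw [map_mul, hF]
    exact congrArg Subtype.val h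
  obtain ⟨a, rfl⟩ := exists_eq_C_of_pderiv_eq_zero hF0
  have hPa : (⟨P, hPA⟩ : A) = algebraMap ℂ A a := Subtype.ext (hF.symm.trans (aeval_C f a))
  rw [hPa] at hP
  refine hP.not_isUnit ((IsUnit.mk0 a ?_).map _)
  rintro rfl
  exact hP.ne_zero (map_zero _)

theorem algebraicIndependent_of_isIntegral_adjoin {n : ℕ} {f : Fin n → MvPolynomial (Fin n) ℂ}
    {A : Subalgebra ℂ (MvPolynomial (Fin n) ℂ)} (hA : A = Algebra.adjoin ℂ (Set.range f))
    (hint : Algebra.IsIntegral A (MvPolynomial (Fin n) ℂ)) : AlgebraicIndependent ℂ f := by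
  subst hA
  have : Algebra.IsAlgebraic (Algebra.adjoin ℂ (Set.range f)) (MvPolynomial (Fin n) ℂ) :=
    hint.isAlgebraic
  exact (Algebra.IsAlgebraic.isTranscendenceBasis_of_le_trdeg_of_finite ℂ f (by simp)).1

theorem uniqueFactorizationMonoid_of_algebraicIndependent {n : ℕ}
    {f : Fin n → MvPolynomial (Fin n) ℂ} {A : Subalgebra ℂ (MvPolynomial (Fin n) ℂ)}
    (hA : A = Algebra.adjoin ℂ (Set.range f)) (hind : AlgebraicIndependent ℂ f) :
    UniqueFactorizationMonoid A := by
  subst hA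
  exact hind.aevalEquiv.toMulEquiv.uniqueFactorizationMonoid inferInstance

section IntegralExtension

variable {A B : Type*} [CommRing A] [IsDomain A] [IsIntegrallyClosed A] [CommRing B] [IsDomain B]
  [Algebra A B] [FaithfulSMul A B]

/-- Divisibility in an integral extension descends to an integrally closed domain. -/
theorem dvd_of_algebraMap_dvd_algebraMap [Algebra.IsIntegral A B] {x y : A}
    (h : algebraMap A B x ∣ algebraMap A B y) : x ∣ y := by
  obtain ⟨z, hz⟩ := h
  by_cases hx : x = 0
  · subst hx
    rw [map_zero, zero_mul] at hz
    rw [(FaithfulSMul.algebraMap_injective A B) (hz.trans (map_zero _).symm)]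
  let K := FractionRing A
  let L := FractionRing B
  let := FractionRing.liftAlgebra A L
  have hxL : algebraMap A L x ≠ 0 := by
    rw [IsScalarTower.algebraMap_apply A B L]
    simpa using hx
  have hzL : algebraMap K L (algebraMap A K y / algebraMap A K x) = algebraMap B L z := by
    rw [map_div₀, ← IsScalarTower.algebraMap_apply, ← IsScalarTower.algebraMap_apply,
      div_eq_iff hxL, IsScalarTower.algebraMap_apply A B L y, hz,
      IsScalarTower.algebraMap_apply A B L x, map_mul, mul_comm]
  have hzint : IsIntegral A (algebraMap B L z) :=
    (Algebra.IsIntegral.isIntegral (R := A) z).algebraMap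
  rw [← hzL, isIntegral_algebraMap_iff (algebraMap K L).injective] at hzint
  obtain ⟨w, hw⟩ := IsIntegrallyClosed.isIntegral_iff.1 hzint
  refine ⟨w, IsFractionRing.injective A K ?_⟩
  have hxK : algebraMap A K x ≠ 0 := by simpa using hx
  rw [map_mul, hw, mul_div_cancel₀ _ hxK]

/-- The contraction of a principal prime ideal along a finite extension of a unique factorization
domain by an integrally closed domain is principal. -/
theorem exists_comap_span_singleton_eq [UniqueFactorizationMonoid A] [IsIntegrallyClosed B]
    [Module.Finite A B] {Q : B} (hQ : Prime Q) :
    ∃ P : A, Prime P ∧ (Ideal.span {Q}).comap (algebraMap A B) = Ideal.span {P} := by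
  let := FractionRing.liftAlgebra A (FractionRing B)
  have hfd : FiniteDimensional (FractionRing A) (FractionRing B) :=
    .of_isLocalization A B (nonZeroDivisors A)
  set c := Algebra.intNorm A B Q with hc
  have hc0 : c ≠ 0 := Algebra.intNorm_ne_zero.2 hQ.ne_zero
  have hp : ((Ideal.span {Q}).comap (algebraMap A B)).IsPrime :=
    have := (Ideal.span_singleton_prime hQ.ne_zero).2 hQ
    Ideal.comap_isPrime _ _
  have hmem : ∀ x : A, x ∈ (Ideal.span {Q}).comap (algebraMap A B) ↔ Q ∣ algebraMap A B x :=
    fun x => by rw [Ideal.mem_comap, Ideal.mem_span_singleton]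
  have hfac : (UniqueFactorizationMonoid.factors c).prod ∈
      (Ideal.span {Q}).comap (algebraMap A B) :=
    (Ideal.mem_iff_of_associated (UniqueFactorizationMonoid.factors_prod hc0)).2
      ((hmem c).2 (Algebra.dvd_algebraMap_intNorm_self A B Q))
  obtain ⟨P, hPfac, hPmem⟩ := (hp.multiset_prod_mem_iff_exists_mem _).1 hfac
  have hP := UniqueFactorizationMonoid.prime_of_factor P hPfac
  refine ⟨P, hP, le_antisymm (fun x hx => ?_) ((Ideal.span_singleton_le_iff_mem _).2 hPmem)⟩
  rw [Ideal.mem_span_singleton]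
  obtain ⟨h, hh⟩ := (hmem x).1 hx
  have hnorm : Algebra.intNorm A B (algebraMap A B x) =
      x ^ Module.finrank (FractionRing A) (FractionRing B) := by
    apply IsFractionRing.injective A (FractionRing A)
    rw [Algebra.algebraMap_intNorm_fractionRing, ← IsScalarTower.algebraMap_apply,
      IsScalarTower.algebraMap_apply A (FractionRing A) (FractionRing B), Algebra.norm_algebraMap,
      map_pow]
  refine hP.dvd_of_dvd_pow (n := Module.finrank (FractionRing A) (FractionRing B)) ?_
  rw [← hnorm, hh, map_mul]
  exact (UniqueFactorizationMonoid.dvd_of_mem_factors hPfac).mul_right _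

end IntegralExtension

/-- Every irreducible element of `B` has a positive ramification index over `A`. -/
theorem exists_ramIdx {n : ℕ} {f : Fin n → MvPolynomial (Fin n) ℂ}
    {A : Subalgebra ℂ (MvPolynomial (Fin n) ℂ)} (hA : A = Algebra.adjoin ℂ (Set.range f))
    (hfin : Module.Finite A (MvPolynomial (Fin n) ℂ)) {Q : MvPolynomial (Fin n) ℂ}
    (hQ : Irreducible Q) : ∃ e, e ≠ 0 ∧ RamIdx A Q e := by
  have := uniqueFactorizationMonoid_of_algebraicIndependent hA
    (algebraicIndependent_of_isIntegral_adjoin hA inferInstance)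
  obtain ⟨P, hP, hPQ⟩ := exists_comap_span_singleton_eq (A := A) hQ.prime
  have hP0 : (P : MvPolynomial (Fin n) ℂ) ≠ 0 := fun h => hP.ne_zero (Subtype.ext h)
  have hfm := FiniteMultiplicity.of_prime_left hQ.prime hP0
  refine ⟨multiplicity Q (P : MvPolynomial (Fin n) ℂ), ?_, P, hP.irreducible, hPQ,
    pow_multiplicity_dvd _ _, hfm.not_pow_dvd_of_multiplicity_lt (Nat.lt_succ_self _)⟩
  have hPmem : P ∈ (Ideal.span {Q}).comap (algebraMap A (MvPolynomial (Fin n) ℂ)) :=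
    hPQ ▸ Ideal.mem_span_singleton_self P
  rw [multiplicity_ne_zero]
  exact Ideal.mem_span_singleton.1 (Ideal.mem_comap.1 hPmem)

/-- The Jacobian divides the discriminant. -/
theorem Jac_dvd_prod {n : ℕ} (hn : 0 < n) {f : Fin n → MvPolynomial (Fin n) ℂ}
    {A : Subalgebra ℂ (MvPolynomial (Fin n) ℂ)} (hA : A = Algebra.adjoin ℂ (Set.range f))
    (hfin : Module.Finite A (MvPolynomial (Fin n) ℂ))
    {S : Finset (MvPolynomial (Fin n) ℂ)} {eIdx : MvPolynomial (Fin n) ℂ → ℕ}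
    (hS : RamReps A S eIdx) : Jac f ∣ ∏ Q ∈ S, Q ^ eIdx Q := by
  have hint : Algebra.IsIntegral A (MvPolynomial (Fin n) ℂ) := inferInstance
  have hJ0 : Jac f ≠ 0 := by
    intro h0
    have hX : Irreducible (X ⟨0, hn⟩ : MvPolynomial (Fin n) ℂ) := X_prime.irreducible
    obtain ⟨e, he, P, -, -, hm⟩ := exists_ramIdx hA hfin hX
    exact not_pow_dvd_Jac hA hint hX P.2 he hm (h0 ▸ dvd_zero _)
  rw [UniqueFactorizationMonoid.dvd_iff_emultiplicity_le hJ0]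
  intro Q hQ
  by_cases hQJ : Q ∣ Jac f
  · obtain ⟨e, he, hr⟩ := exists_ramIdx hA hfin hQ.irreducible
    have he1 : 1 < e := by
      obtain ⟨P, -, -, hm⟩ := hr
      by_contra h
      obtain rfl : e = 1 := by omega
      exact not_pow_dvd_Jac hA hint hQ.irreducible P.2 he hm (by rwa [pow_one])
    obtain ⟨Q', ⟨hQ'S, hQQ'⟩, -⟩ := hS.2.2 Q ⟨hQ.irreducible, e, hr, he1⟩
    obtain ⟨hQ', ⟨P, -, -, hm⟩, he'⟩ := hS.1 Q' hQ'S
    rw [← emultiplicity_eq_of_associated_left hQQ', ← emultiplicity_eq_of_associated_left hQQ']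
    refine le_trans (le_of_lt (b := (eIdx Q' : ℕ∞)) ?_) ?_
    · rw [emultiplicity_lt_iff_not_dvd]
      exact not_pow_dvd_Jac hA hint hQ' P.2 (by omega) hm
    · exact le_emultiplicity_of_pow_dvd (Finset.dvd_prod_of_mem (fun Q => Q ^ eIdx Q) hQ'S)
  · rw [emultiplicity_eq_zero.2 hQJ]
    exact zero_le

/-- The discriminant divides every element of `A` divisible by the Jacobian. -/
theorem prod_dvd_of_Jac_dvd {n : ℕ} {f : Fin n → MvPolynomial (Fin n) ℂ}
    {A : Subalgebra ℂ (MvPolynomial (Fin n) ℂ)} (hA : A = Algebra.adjoin ℂ (Set.range f))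
    (hind : AlgebraicIndependent ℂ f)
    {S : Finset (MvPolynomial (Fin n) ℂ)} {eIdx : MvPolynomial (Fin n) ℂ → ℕ}
    (hS : RamReps A S eIdx) {x : A} (hx : Jac f ∣ (x : MvPolynomial (Fin n) ℂ)) :
    ∏ Q ∈ S, Q ^ eIdx Q ∣ (x : MvPolynomial (Fin n) ℂ) := by
  refine Finset.prod_dvd_of_isRelPrime (fun Q hQ Q' hQ' hne => ?_) fun Q hQ => ?_
  · refine IsRelPrime.pow ?_
    refine (hS.1 Q hQ).1.isRelPrime_iff_not_dvd.2 fun h => hS.2.1 Q hQ Q' hQ' hne ?_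
    exact (hS.1 Q hQ).1.associated_of_dvd (hS.1 Q' hQ').1 h
  · obtain ⟨hQi, hr, he⟩ := hS.1 Q hQ
    have hQx := (dvd_Jac_of_one_lt hA hind hQi he hr).trans hx
    obtain ⟨P, -, hPQ, hm, -⟩ := hr
    have hxP : x ∈ Ideal.span {P} := by
      rw [← hPQ, Ideal.mem_comap, Ideal.mem_span_singleton]
      exact hQx
    exact hm.trans (map_dvd A.val (Ideal.mem_span_singleton.1 hxP))

end

open MvPolynomial in
theorem contraction_of_jacobian_eq_span_discriminant {n : ℕ} (hn : 0 < n)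
    (b : Fin n → ℕ) (hb : ∀ i, 0 < b i) (a : Fin n → ℕ)
    (f : Fin n → MvPolynomial (Fin n) ℂ)
    (hhom : ∀ i, IsWeightedHomogeneous b (f i) (a i))
    (A : Subalgebra ℂ (MvPolynomial (Fin n) ℂ))
    (hA : A = Algebra.adjoin ℂ (Set.range f))
    (hfin : Module.Finite A (MvPolynomial (Fin n) ℂ))
    (S : Finset (MvPolynomial (Fin n) ℂ)) (eIdx : MvPolynomial (Fin n) ℂ → ℕ)
    (hS : RamReps A S eIdx)
    (hD : (∏ Q ∈ S, Q ^ eIdx Q) ∈ A) :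
    (Ideal.span {Jac f}).comap (algebraMap A (MvPolynomial (Fin n) ℂ)) =
      Ideal.span {(⟨∏ Q ∈ S, Q ^ eIdx Q, hD⟩ : A)} := by
  have hint : Algebra.IsIntegral A (MvPolynomial (Fin n) ℂ) := inferInstance
  have hind := algebraicIndependent_of_isIntegral_adjoin hA hint
  have := uniqueFactorizationMonoid_of_algebraicIndependent hA hind
  ext x
  rw [Ideal.mem_comap, Ideal.mem_span_singleton, Ideal.mem_span_singleton]
  refine ⟨fun h => ?_, fun h => ?_⟩
  · exact dvd_of_algebraMap_dvd_algebraMap (B := MvPolynomial (Fin n) ℂ)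
      (prod_dvd_of_Jac_dvd hA hind hS h)
  · have hxD : ∏ Q ∈ S, Q ^ eIdx Q ∣ (x : MvPolynomial (Fin n) ℂ) := by
      obtain ⟨y, rfl⟩ := h
      exact Dvd.intro _ rfl
    exact (Jac_dvd_prod hn hA hfin hS).trans hxD
end

section
/- The zero set of the Jacobian is the union of the zero sets of the ramified irreducibles: a point x ∈ ℂⁿ satisfies J(x) = 0 if and only if there exists a ramified irreducible polynomial Q ∈ B with Q(x) = 0. -/
namespace MvPolynomial

theorem derivation_aeval {ι σ M : Type*} [Fintype ι] [AddCommGroup M] [Module ℂ M]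
    [Module (MvPolynomial σ ℂ) M] [IsScalarTower ℂ (MvPolynomial σ ℂ) M]
    (D : Derivation ℂ (MvPolynomial σ ℂ) M)
    (f : ι → MvPolynomial σ ℂ) (g : MvPolynomial ι ℂ) :
    D (aeval f g) = ∑ i, aeval f (pderiv i g) • D (f i) := by
  classical
  induction g using MvPolynomial.induction_on with
  | C a => simp
  | add p q hp hq => simp only [map_add, hp, hq, add_smul, Finset.sum_add_distrib]
  | mul_X p i hp =>
    simp only [map_mul, aeval_X, Derivation.leibniz, hp, pderiv_X, map_add, smul_eq_mul,
      add_smul, Finset.sum_add_distrib, Finset.smul_sum, mul_smul]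
    congr 1
    simp [Pi.single_apply, apply_ite, ite_smul, Finset.sum_ite_eq]

theorem totalDegree_pderiv_lt {σ : Type*} {p : MvPolynomial σ ℂ} {i : σ} (h : pderiv i p ≠ 0) :
    (pderiv i p).totalDegree < p.totalDegree := by
  have key : ∀ m ∈ (pderiv i p).support, (m.sum fun _ e => e) + 1 ≤ p.totalDegree := by
    intro m hm
    rw [mem_support_iff, coeff_pderiv] at hm
    have := le_totalDegree (mem_support_iff.mpr (left_ne_zero_of_mul hm))
    rwa [Finsupp.sum_add_index' (by simp) (by simp), Finsupp.sum_single_index rfl] at this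
  obtain ⟨m, hm⟩ := Finset.nonempty_of_ne_empty (mt support_eq_empty.mp h)
  have hpos : 0 < p.totalDegree := (Nat.succ_pos _).trans_le (key m hm)
  exact (Finset.sup_lt_iff hpos).mpr key

theorem exists_pderiv_ne_zero {σ : Type*} {p : MvPolynomial σ ℂ} (h : p.totalDegree ≠ 0) :
    ∃ i, pderiv i p ≠ 0 := by
  contrapose! h
  rw [totalDegree_eq_zero_iff]
  intro m hm i
  by_contra hi
  have h0 : coeff (m - Finsupp.single i 1) (pderiv i p) = 0 := by rw [h i, coeff_zero]
  rw [coeff_pderiv, tsub_add_cancel_of_le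
    (Finsupp.single_le_iff.mpr (Nat.one_le_iff_ne_zero.mpr hi)), mul_eq_zero] at h0
  exact h0.elim (mem_support_iff.mp hm) (Nat.cast_add_one_ne_zero _)

theorem dvd_jac_mul_aeval_pderiv {n : ℕ} (f : Fin n → MvPolynomial (Fin n) ℂ)
    (g : MvPolynomial (Fin n) ℂ) {Q : MvPolynomial (Fin n) ℂ}
    (hQ : ∀ j, Q ∣ pderiv j (aeval f g)) (i : Fin n) :
    Q ∣ Jac f * aeval f (pderiv i g) := by
  set M : Matrix (Fin n) (Fin n) (MvPolynomial (Fin n) ℂ) :=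
    Matrix.of fun i j => pderiv j (f i)
  set w : Fin n → MvPolynomial (Fin n) ℂ := fun i => aeval f (pderiv i g)
  have hw : Matrix.vecMul w M = fun j => pderiv j (aeval f g) := by
    ext1 j
    rw [derivation_aeval]
    rfl
  have h : Jac f * w i = Matrix.vecMul (fun j => pderiv j (aeval f g)) M.adjugate i := by
    rw [← hw, Matrix.vecMul_vecMul, Matrix.mul_adjugate, Matrix.vecMul_smul, Matrix.vecMul_one]
    rfl
  rw [h, Matrix.vecMul, dotProduct]
  exact Finset.dvd_sum fun j _ => (hQ j).mul_right _

theorem algebraicIndependent_of_jac_ne_zero {n : ℕ} {f : Fin n → MvPolynomial (Fin n) ℂ}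
    (hJ : Jac f ≠ 0) : AlgebraicIndependent ℂ f := by
  rw [algebraicIndependent_iff]
  suffices ∀ (d : ℕ) (g : MvPolynomial (Fin n) ℂ), g.totalDegree = d → aeval f g = 0 → g = 0 from
    fun g => this _ g rfl
  intro d
  induction d using Nat.strong_induction_on with
  | _ d ih =>
    intro g hd hg
    by_cases hdeg : g.totalDegree = 0
    · rw [totalDegree_eq_zero_iff_eq_C.mp hdeg] at hg ⊢
      simpa [algebraMap_eq] using hg
    · obtain ⟨i, hi⟩ := exists_pderiv_ne_zero hdeg
      have h := zero_dvd_iff.mp (dvd_jac_mul_aeval_pderiv f g (Q := 0) (fun j => by rw [hg, map_zero]) i)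
      exact absurd (ih _ (hd ▸ totalDegree_pderiv_lt hi) _ rfl
        ((mul_eq_zero.mp h).resolve_left hJ)) hi

end MvPolynomial

/-- In characteristic zero, a derivation from `B` to a quotient domain of `B` that vanishes on a
subalgebra over which `B` is integral, and on the kernel of the quotient map, is zero. -/
theorem Derivation.eq_zero_of_isIntegral {B : Type*} [CommRing B] [Algebra ℂ B]
    (A : Subalgebra ℂ B) [Algebra.IsIntegral A B] (I : Ideal B) [I.IsPrime]
    (D : Derivation A B (B ⧸ I)) (hD : ∀ x ∈ I, D x = 0) : D = 0 := by
  have key : ∀ (d : ℕ) (x : B) (p : Polynomial A), p.Monic → p.natDegree = d →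
      Polynomial.aeval x p ∈ I → D x = 0 := by
    intro d
    induction d with
    | zero =>
      intro x p hp hd hx
      rw [hp.natDegree_eq_zero.mp hd] at hx
      simp only [map_one] at hx
      exact absurd ((Ideal.eq_top_iff_one I).mpr hx) Ideal.IsPrime.ne_top'
    | succ d ih =>
      intro x p hp hd hx
      have h := hD _ hx
      rw [Derivation.map_aeval, Algebra.smul_def, mul_eq_zero] at h
      refine h.elim (fun h => ?_) id
      have hx' : Polynomial.aeval x p.derivative ∈ I := Ideal.Quotient.eq_zero_iff_mem.mp h
      have hc : (algebraMap ℂ A ((d : ℂ) + 1)⁻¹) * ((d : A) + 1) = 1 := by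
        rw [← _root_.map_natCast (algebraMap ℂ A) d, ← map_one (algebraMap ℂ A), ← _root_.map_add,
          ← map_mul, inv_mul_cancel₀ (Nat.cast_add_one_ne_zero d)]
      have hlead : (Polynomial.C (algebraMap ℂ A ((d : ℂ) + 1)⁻¹) * p.derivative).coeff d = 1 := by
        rw [Polynomial.coeff_C_mul, Polynomial.coeff_derivative, ← hd, hp.coeff_natDegree, one_mul,
          hc]
      have hle : (Polynomial.C (algebraMap ℂ A ((d : ℂ) + 1)⁻¹) * p.derivative).natDegree ≤ d :=
        (Polynomial.natDegree_C_mul_le _ _).trans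
          ((Polynomial.natDegree_derivative_le p).trans (by omega))
      have hnt : Nontrivial A := by
        by_contra hA
        rw [not_nontrivial_iff_subsingleton] at hA
        refine Ideal.IsPrime.ne_top' ((Ideal.eq_top_iff_one I).mpr ?_)
        rw [← map_one (algebraMap A B), Subsingleton.elim (1 : A) 0, map_zero]
        exact I.zero_mem
      have hmon := Polynomial.monic_of_natDegree_le_of_coeff_eq_one d hle hlead
      refine ih x _ hmon (le_antisymm hle ?_) ?_
      · exact Polynomial.le_natDegree_of_ne_zero (by rw [hlead]; exact one_ne_zero)
      · rw [map_mul]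
        exact I.mul_mem_left _ hx'
  ext x
  obtain ⟨p, hp, hx⟩ := Algebra.IsIntegral.isIntegral (R := A) x
  exact key _ x p hp rfl (by rw [Polynomial.aeval_def, hx]; exact I.zero_mem)

/-- A height-one prime of a factorial integral extension contracts to a principal prime. -/
theorem Prime.exists_irreducible_comap_span {A B : Type*} [CommRing A] [IsDomain A]
    [UniqueFactorizationMonoid A] [CommRing B] [IsDomain B] [UniqueFactorizationMonoid B]
    [Algebra A B] [Algebra.IsIntegral A B] [FaithfulSMul A B] {Q : B} (hQ : Prime Q) :
    ∃ P : A, Irreducible P ∧ (Ideal.span {Q}).comap (algebraMap A B) = Ideal.span {P} := by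
  have hprime : (Ideal.span {Q}).IsPrime := (Ideal.span_singleton_prime hQ.ne_zero).mpr hQ
  have hne : (Ideal.span {Q}).comap (algebraMap A B) ≠ ⊥ := fun h =>
    hQ.ne_zero (Ideal.span_singleton_eq_bot.mp (Ideal.eq_bot_of_comap_eq_bot h))
  obtain ⟨P, hPmem, hP⟩ := Ideal.IsPrime.exists_mem_prime_of_ne_bot inferInstance hne
  have hPprime : (Ideal.span {P}).IsPrime := (Ideal.span_singleton_prime hP.ne_zero).mpr hP
  have hPle : Ideal.span {P} ≤ (Ideal.span {Q}).comap (algebraMap A B) :=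
    (Ideal.span_singleton_le_iff_mem _).mpr hPmem
  have : (Ideal.span {Q}).LiesOver ((Ideal.span {Q}).comap (algebraMap A B)) := ⟨rfl⟩
  obtain ⟨q, hqle, hq, hqover⟩ := Ideal.exists_ideal_le_liesOver_of_le (Ideal.span {Q}) hPle
  have hqne : q ≠ ⊥ := by
    rintro rfl
    have : algebraMap A B P ∈ (⊥ : Ideal B) := by
      rw [← Ideal.mem_comap, ← Ideal.under_def, ← hqover.over]
      exact Ideal.mem_span_singleton_self P
    exact hP.ne_zero ((FaithfulSMul.algebraMap_eq_zero_iff A B).mp this)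
  obtain ⟨R, hRmem, hR⟩ := Ideal.IsPrime.exists_mem_prime_of_ne_bot hq hqne
  have hQR : Associated Q R :=
    hQ.associated_of_dvd hR (Ideal.mem_span_singleton.mp (hqle hRmem))
  have hqeq : q = Ideal.span {Q} := by
    refine le_antisymm hqle ((Ideal.span_singleton_le_iff_mem _).mpr ?_)
    exact q.mem_of_dvd hQR.symm.dvd hRmem
  exact ⟨P, hP.irreducible, by rw [← hqeq, hqover.over, Ideal.under_def]⟩

namespace MvPolynomial

variable {n : ℕ} {f : Fin n → MvPolynomial (Fin n) ℂ}

theorem jac_notMem_of_isPrime [Algebra.IsIntegral (Algebra.adjoin ℂ (Set.range f))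
      (MvPolynomial (Fin n) ℂ)] (I : Ideal (MvPolynomial (Fin n) ℂ)) [I.IsPrime]
    (hI : ∀ D : Derivation (Algebra.adjoin ℂ (Set.range f)) (MvPolynomial (Fin n) ℂ)
      (MvPolynomial (Fin n) ℂ ⧸ I), ∀ x ∈ I, D x = 0) :
    Jac f ∉ I := by
  intro hJ
  set M : Matrix (Fin n) (Fin n) (MvPolynomial (Fin n) ℂ) :=
    Matrix.of fun i j => pderiv j (f i)
  have hdet : ((Ideal.Quotient.mk I).mapMatrix M).det = 0 := by
    rw [← RingHom.map_det]
    exact Ideal.Quotient.eq_zero_iff_mem.mpr hJ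
  obtain ⟨v, hv, hMv⟩ := Matrix.exists_mulVec_eq_zero_iff.mpr hdet
  let D₀ : Derivation ℂ (MvPolynomial (Fin n) ℂ) (MvPolynomial (Fin n) ℂ ⧸ I) := mkDerivation ℂ v
  have hf : ∀ i, D₀ (f i) = 0 := by
    intro i
    have h := derivation_aeval D₀ X (f i)
    simp only [aeval_X_left, AlgHom.id_apply, D₀, mkDerivation_X] at h
    exact h.trans (congrFun hMv i)
  have hA : ∀ y ∈ Algebra.adjoin ℂ (Set.range f), D₀ y = 0 := by
    intro y hy
    induction hy using Algebra.adjoin_induction with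
    | mem y hy => obtain ⟨i, rfl⟩ := hy; exact hf i
    | algebraMap c => exact D₀.map_algebraMap c
    | add y z _ _ hy hz => rw [map_add, hy, hz, add_zero]
    | mul y z _ _ hy hz => rw [D₀.leibniz, hy, hz, smul_zero, smul_zero, add_zero]
  let D : Derivation (Algebra.adjoin ℂ (Set.range f)) (MvPolynomial (Fin n) ℂ)
      (MvPolynomial (Fin n) ℂ ⧸ I) :=
    { toFun := D₀
      map_add' := map_add D₀
      map_smul' := fun c x => by
        rw [Algebra.smul_def, D₀.leibniz]
        erw [hA _ c.2]
        rw [smul_zero, add_zero]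
        rfl
      map_one_eq_zero' := D₀.map_one_eq_zero
      leibniz' := D₀.leibniz }
  have hD := Derivation.eq_zero_of_isIntegral _ I D (hI D)
  refine hv ?_
  funext j
  have : D (X j) = 0 := by rw [hD, Derivation.zero_apply]
  exact (mkDerivation_X ℂ v j).symm.trans this

theorem jac_ne_zero [Algebra.IsIntegral (Algebra.adjoin ℂ (Set.range f))
    (MvPolynomial (Fin n) ℂ)] : Jac f ≠ 0 := by
  refine fun h => jac_notMem_of_isPrime (f := f) ⊥ (fun D x hx => ?_) (by simp [h])
  rw [(Submodule.mem_bot _).mp hx, map_zero]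

theorem not_dvd_jac_of_eq_mul [Algebra.IsIntegral (Algebra.adjoin ℂ (Set.range f))
    (MvPolynomial (Fin n) ℂ)] {Q R : MvPolynomial (Fin n) ℂ} (hQ : Prime Q) (hR : ¬ Q ∣ R)
    (hQR : Q * R ∈ Algebra.adjoin ℂ (Set.range f)) : ¬ Q ∣ Jac f := by
  have hprime : (Ideal.span {Q}).IsPrime := (Ideal.span_singleton_prime hQ.ne_zero).mpr hQ
  rw [← Ideal.mem_span_singleton]
  refine jac_notMem_of_isPrime _ fun D x hx => ?_
  have hzero (y : MvPolynomial (Fin n) ℂ ⧸ Ideal.span {Q}) :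
      Ideal.Quotient.mk (Ideal.span {Q}) Q * y = 0 := by
    rw [Ideal.Quotient.eq_zero_iff_mem.mpr (Ideal.mem_span_singleton_self Q), zero_mul]
  have h : D (Q * R) = 0 := D.map_algebraMap ⟨Q * R, hQR⟩
  rw [D.leibniz, Algebra.smul_def, Algebra.smul_def, Ideal.Quotient.algebraMap_eq, hzero, zero_add,
    mul_eq_zero, Ideal.Quotient.eq_zero_iff_mem, Ideal.mem_span_singleton] at h
  obtain ⟨s, rfl⟩ := Ideal.mem_span_singleton.mp hx
  rw [D.leibniz, Algebra.smul_def, Ideal.Quotient.algebraMap_eq, hzero, h.resolve_left hR, smul_zero, add_zero]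

theorem isRamified_of_dvd_jac [Module.Finite (Algebra.adjoin ℂ (Set.range f))
    (MvPolynomial (Fin n) ℂ)] {Q : MvPolynomial (Fin n) ℂ} (hQ : Irreducible Q)
    (hQJ : Q ∣ Jac f) : IsRamified (Algebra.adjoin ℂ (Set.range f)) Q := by
  have hind := algebraicIndependent_of_jac_ne_zero (jac_ne_zero (f := f))
  have : UniqueFactorizationMonoid (Algebra.adjoin ℂ (Set.range f)) :=
    hind.aevalEquiv.toMulEquiv.uniqueFactorizationMonoid inferInstance
  obtain ⟨P, hP, hcomap⟩ :=
    hQ.prime.exists_irreducible_comap_span (A := Algebra.adjoin ℂ (Set.range f))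
  have hfin : FiniteMultiplicity Q (P : MvPolynomial (Fin n) ℂ) :=
    FiniteMultiplicity.of_prime_left hQ.prime (by simpa using hP.ne_zero)
  have hmult : MultIs Q (P : MvPolynomial (Fin n) ℂ) (multiplicity Q (P : MvPolynomial _ ℂ)) :=
    ⟨pow_multiplicity_dvd _ _, hfin.not_pow_dvd_of_multiplicity_lt (Nat.lt_succ_self _)⟩
  have hQP : Q ∣ (P : MvPolynomial (Fin n) ℂ) := by
    rw [← Ideal.mem_span_singleton]
    exact Ideal.mem_comap.mp (hcomap ▸ Ideal.mem_span_singleton_self P)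
  refine ⟨hQ, _, ⟨P, hP, hcomap, hmult⟩, ?_⟩
  by_contra hle
  obtain ⟨R, hR⟩ := hQP
  refine not_dvd_jac_of_eq_mul hQ.prime (fun hQR => hmult.2 ?_) (hR ▸ P.2) hQJ
  refine (pow_dvd_pow Q (by omega : _ ≤ 2)).trans ?_
  rw [hR, sq]
  exact mul_dvd_mul_left Q hQR

theorem dvd_jac_of_isRamified [Module.Finite (Algebra.adjoin ℂ (Set.range f))
    (MvPolynomial (Fin n) ℂ)] {Q : MvPolynomial (Fin n) ℂ}
    (hQ : IsRamified (Algebra.adjoin ℂ (Set.range f)) Q) : Q ∣ Jac f := by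
  obtain ⟨hQ, e, ⟨P, hP, hcomap, hdvd, -⟩, he⟩ := hQ
  have hind := algebraicIndependent_of_jac_ne_zero (jac_ne_zero (f := f))
  obtain ⟨g, rfl⟩ := hind.aevalEquiv.surjective P
  have hg : Irreducible g := (MulEquiv.irreducible_iff hind.aevalEquiv).mp hP
  replace hdvd : Q ^ e ∣ aeval f g := hind.algebraMap_aevalEquiv g ▸ hdvd
  by_contra hJ
  have hdeg : g.totalDegree ≠ 0 := fun h => by
    rw [totalDegree_eq_zero_iff_eq_C.mp h] at hg
    exact hg.not_isUnit ((Ne.isUnit fun h0 => hg.ne_zero (by rw [h0, C_0])).map C)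
  obtain ⟨i, hi⟩ := exists_pderiv_ne_zero hdeg
  have hQd : ∀ j, Q ∣ pderiv j (aeval f g) := by
    obtain ⟨R, hR⟩ := (pow_dvd_pow Q he).trans hdvd
    intro j
    rw [hR, Derivation.leibniz, Derivation.leibniz_pow]
    exact dvd_add ((dvd_pow_self Q two_ne_zero).mul_right _)
      (by simp [mul_left_comm R, mul_left_comm _ Q])
  have hdvd' := (hQ.prime.dvd_or_dvd (dvd_jac_mul_aeval_pderiv f g hQd i)).resolve_left hJ
  have hmem : hind.aevalEquiv (pderiv i g) ∈ Ideal.span {hind.aevalEquiv g} := by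
    rw [← hcomap, Ideal.mem_comap, Ideal.mem_span_singleton, hind.algebraMap_aevalEquiv]
    exact hdvd'
  obtain ⟨s, hs⟩ := (map_dvd_iff hind.aevalEquiv).mp (Ideal.mem_span_singleton.mp hmem)
  have hlt := totalDegree_pderiv_lt hi
  rw [hs] at hi hlt
  rw [totalDegree_mul_of_isDomain (left_ne_zero_of_mul hi) (right_ne_zero_of_mul hi)] at hlt
  omega

end MvPolynomial

open MvPolynomial in
theorem zero_set_jacobian_eq_union_ramified {n : ℕ} (hn : 0 < n)
    (b : Fin n → ℕ) (hb : ∀ i, 0 < b i) (a : Fin n → ℕ)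
    (f : Fin n → MvPolynomial (Fin n) ℂ)
    (hhom : ∀ i, IsWeightedHomogeneous b (f i) (a i))
    (A : Subalgebra ℂ (MvPolynomial (Fin n) ℂ))
    (hA : A = Algebra.adjoin ℂ (Set.range f))
    (hfin : Module.Finite A (MvPolynomial (Fin n) ℂ))
    (x : Fin n → ℂ) :
    eval x (Jac f) = 0 ↔
      ∃ Q : MvPolynomial (Fin n) ℂ, IsRamified A Q ∧ eval x Q = 0 := by
  subst hA
  constructor
  · intro hx
    have hJ : Jac f ≠ 0 := jac_ne_zero
    have hprod : (UniqueFactorizationMonoid.factors (Jac f)).prod ∈ RingHom.ker (eval x) :=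
      (RingHom.ker (eval x)).mem_of_dvd (UniqueFactorizationMonoid.factors_prod hJ).symm.dvd hx
    obtain ⟨Q, hQ, hQx⟩ :=
      (RingHom.ker_isPrime (eval x)).multiset_prod_mem_iff_exists_mem _ |>.mp hprod
    exact ⟨Q, isRamified_of_dvd_jac (UniqueFactorizationMonoid.irreducible_of_factor Q hQ)
      (UniqueFactorizationMonoid.dvd_of_mem_factors hQ), hQx⟩
  · rintro ⟨Q, hQ, hx⟩
    obtain ⟨R, hR⟩ := dvd_jac_of_isRamified hQ
    rw [hR, map_mul, hx, zero_mul]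
end
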